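/- Associativity of the extended operation ∘: for all a, b ∈ S and every positive integer c, one has a∘b ∈ S and a∘(b∘c) = (a∘b)∘c. -/

import Mathlib

open scoped BigOperators

namespace LuckyPaper

/-- Rank of `k` in `A`: the number of elements of `A` that are `≤ k`
(the 1-indexed position of `k` in `A` when `k ∈ A`). -/
noncomputable def rank (A : Set ℕ) (k : ℕ) : ℕ := Set.ncard {m | m ∈ A ∧ m ≤ k}

/-- One sieve step: delete every `d`-th element of `A` (listed in increasing order). -/
noncomputable def step (A : Set ℕ) (d : ℕ) : Set ℕ := {k | k ∈ A ∧ ¬ d ∣ rank A k}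

/-- The lucky sieve: `sieve i = (A_i, l_i)`, where `A_0 = {1,2,3,…}`, `l_0 = 1` (dummy),
`l_{i+1}` is the smallest element of `A_i` larger than `l_i`, and `A_{i+1}` is obtained
from `A_i` by deleting every `l_{i+1}`-th element.  In particular `l_1 = 2`. -/
noncomputable def sieve : ℕ → Set ℕ × ℕ
  | 0 => ({n | 1 ≤ n}, 1)
  | i + 1 =>
      let p := sieve i
      let d := sInf {m | m ∈ p.1 ∧ p.2 < m}
      (step p.1 d, d)

/-- `A i` : the set of survivors after `i` steps of the lucky sieve. -/
noncomputable def A (i : ℕ) : Set ℕ := (sieve i).1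

/-- `l i` : the `i`-th sieve parameter (`l 1 = 2`, `l 2 = 3`, `l 3 = 7`, `l 4 = 9`, …);
with this convention `l n` is the `n`-th lucky number for `n ≥ 2`. -/
noncomputable def l (i : ℕ) : ℕ := (sieve i).2

/-- The set of lucky numbers `A_∞ = ⋂ i, A i = {1, 3, 7, 9, 13, 15, 21, 25, …}`. -/
noncomputable def LuckySet : Set ℕ := ⋂ i, A i

/-- `L x` : the number of lucky numbers that are `≤ x`. -/
noncomputable def L (x : ℝ) : ℕ := Set.ncard {m | m ∈ LuckySet ∧ (m : ℝ) ≤ x}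

/-- `R i x = #{k ∈ A_{i-1} : k ≤ x}`. -/
noncomputable def R (i : ℕ) (x : ℝ) : ℕ := Set.ncard {m | m ∈ A (i - 1) ∧ (m : ℝ) ≤ x}

/-- `𝕃 = {l 1, l 2, l 3, …} = {2, 3, 7, 9, 13, …}`. -/
noncomputable def Ell : Set ℕ := {a | ∃ i, 1 ≤ i ∧ l i = a}

/-- `starIdx i m` : the `m`-th number deleted at step `i` of the sieve, i.e. the
`(l i * m)`-th smallest element of `A (i-1)` (`Nat.nth` is 0-indexed). -/
noncomputable def starIdx (i m : ℕ) : ℕ := Nat.nth (· ∈ A (i - 1)) (l i * m - 1)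

/-- The binary operation `*` : for `a ∈ 𝕃`, `star a m = a * m` is the `m`-th number
deleted at the (unique) step `i ≥ 1` with `l i = a`. -/
noncomputable def star (a m : ℕ) : ℕ := starIdx (sInf {i | 1 ≤ i ∧ l i = a}) m

/-- `evalStar [a₁, …, a_k] = a₁ * (a₂ * (⋯ * a_k)⋯)`. -/
noncomputable def evalStar : List ℕ → ℕ
  | [] => 1
  | [a] => a
  | a :: b :: rest => star a (evalStar (b :: rest))

/-- `t = (a₁, …, a_k)` is a lucky factorization of `n` : `k ≥ 1`, `a_j ∈ 𝕃` for `j < k`,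
`a_k` is a lucky number (possibly 1), and `n = a₁*(a₂*(⋯*a_k)⋯)`. -/
def IsLuckyFactorization (n : ℕ) (t : List ℕ) : Prop :=
  t ≠ [] ∧ (∀ a ∈ t.dropLast, a ∈ Ell) ∧ t.getLast! ∈ LuckySet ∧ evalStar t = n

/-- The canonical tuple of `n` given by the fundamental theorem of arithmetic
for lucky numbers. -/
noncomputable def canonicalTuple (n : ℕ) : List ℕ :=
  haveI := Classical.propDecidable (∃ t, IsLuckyFactorization n t)
  if h : ∃ t, IsLuckyFactorization n t then h.choose else []

/-- `Ω°(n)` : the length of the canonical tuple of `n`. -/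
noncomputable def bigOmega (n : ℕ) : ℕ := (canonicalTuple n).length

/-- `ω°(n)` : the number of distinct entries of the canonical tuple of `n`. -/
noncomputable def smallOmega (n : ℕ) : ℕ := (canonicalTuple n).dedup.length

/-- `d°(n)` : the number of distinct nonempty contiguous subtuples (infixes) of the
canonical tuple of `n`. -/
noncomputable def dCirc (n : ℕ) : ℕ :=
  Set.ncard {s : List ℕ | s ≠ [] ∧ s <:+: canonicalTuple n}

/-- `B` : positive integers whose canonical tuple has last entry `≠ 1`. -/
noncomputable def Bset : Set ℕ := {n | 1 ≤ n ∧ (canonicalTuple n).getLast! ≠ 1}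

/-- `C` : positive integers whose canonical tuple ends with the pair `(2, 1)`. -/
noncomputable def Cset : Set ℕ := {n | 1 ≤ n ∧ ∃ t, canonicalTuple n = t ++ [2, 1]}

/-- `S = B ∪ C`. -/
noncomputable def Sset : Set ℕ := Bset ∪ Cset

/-- The `𝕃`-tuple of `a ∈ S` : the canonical tuple of `a` if it does not end in `1`,
else the canonical tuple with the final `1` removed (so it ends in `2`). -/
noncomputable def ellTuple (a : ℕ) : List ℕ :=
  if (canonicalTuple a).getLast! = 1 then (canonicalTuple a).dropLast else canonicalTuple a

/-- The extended operation `∘` : if the `𝕃`-tuple of `a` is `(t₁, …, t_k)`, then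
`a ∘ b = t₁*(t₂*(⋯*(t_k*b)⋯))`. -/
noncomputable def circ (a b : ℕ) : ℕ := (ellTuple a).foldr star b

theorem rank_eq_count (s : Set ℕ) [DecidablePred (· ∈ s)] (k : ℕ) :
    rank s k = Nat.count (· ∈ s) (k + 1) := by
  rw [rank, Nat.count_eq_card_filter_range, ← Set.ncard_coe_finset]
  congr 1
  ext m
  simp [and_comm]

theorem rank_nth {s : Set ℕ} (hs : s.Infinite) (k : ℕ) :
    rank s (Nat.nth (· ∈ s) k) = k + 1 := by
  classical
  rw [rank_eq_count, Nat.count_succ, if_pos (Nat.nth_mem_of_infinite (p := (· ∈ s)) hs k),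
    Nat.count_nth_of_infinite (p := (· ∈ s)) hs]

theorem nth_rank {s : Set ℕ} {n : ℕ} (hn : n ∈ s) :
    Nat.nth (· ∈ s) (rank s n - 1) = n := by
  classical
  rw [rank_eq_count, Nat.count_succ, if_pos hn, Nat.add_sub_cancel]
  exact Nat.nth_count hn

theorem step_infinite {s : Set ℕ} (hs : s.Infinite) {d : ℕ} (hd : 2 ≤ d) :
    (step s d).Infinite := by
  have hinj : Function.Injective fun k => Nat.nth (· ∈ s) (d * k) := fun a b h =>
    Nat.eq_of_mul_eq_mul_left (by omega) (Nat.nth_injective hs h)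
  refine (Set.infinite_range_of_injective hinj).mono ?_
  rintro _ ⟨k, rfl⟩
  refine ⟨Nat.nth_mem_of_infinite hs _, fun h => ?_⟩
  rw [rank_nth hs] at h
  have := Nat.le_of_dvd one_pos ((Nat.dvd_add_right (dvd_mul_right d k)).1 h)
  omega

theorem l_succ (i : ℕ) : l (i + 1) = sInf {m | m ∈ A i ∧ l i < m} := rfl

theorem A_succ (i : ℕ) : A (i + 1) = step (A i) (l (i + 1)) := rfl

theorem l_succ_mem_of_infinite {i : ℕ} (h : (A i).Infinite) :
    l (i + 1) ∈ A i ∧ l i < l (i + 1) := by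
  rw [l_succ]
  exact Nat.sInf_mem (s := {m | m ∈ A i ∧ l i < m}) (h.exists_gt (l i))

theorem A_infinite_and_one_le_l (i : ℕ) : (A i).Infinite ∧ 1 ≤ l i := by
  induction i with
  | zero => exact ⟨Set.infinite_of_not_bddAbove (not_bddAbove_Ici (a := 1)), le_rfl⟩
  | succ i ih =>
    have h := (l_succ_mem_of_infinite ih.1).2
    have h' := ih.2
    exact ⟨A_succ i ▸ step_infinite ih.1 (by omega), by omega⟩

theorem A_infinite (i : ℕ) : (A i).Infinite := (A_infinite_and_one_le_l i).1

theorem l_strictMono : StrictMono l :=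
  strictMono_nat_of_lt_succ fun i => (l_succ_mem_of_infinite (A_infinite i)).2

theorem two_le_l_succ (i : ℕ) : 2 ≤ l (i + 1) := by
  have := l_strictMono (Nat.lt_succ_self i)
  have := (A_infinite_and_one_le_l i).2
  simp only [Nat.succ_eq_add_one] at *
  omega

theorem A_antitone : Antitone A :=
  antitone_nat_of_succ_le fun i _ h => (A_succ i ▸ h : _ ∈ step _ _).1

theorem one_le_of_mem_A {i n : ℕ} (h : n ∈ A i) : 1 ≤ n := A_antitone (Nat.zero_le i) h

theorem one_le_of_mem_LuckySet {n : ℕ} (h : n ∈ LuckySet) : 1 ≤ n :=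
  one_le_of_mem_A (Set.mem_iInter.1 h 0)

theorem mem_Ell_of_mem_LuckySet {n : ℕ} (h : n ∈ LuckySet) (h1 : n ≠ 1) : n ∈ Ell := by
  classical
  have hex : ∃ j, n ≤ l j := ⟨n, l_strictMono.id_le n⟩
  obtain ⟨j, hj⟩ : ∃ j, Nat.find hex = j := ⟨_, rfl⟩
  have hle : n ≤ l j := hj ▸ Nat.find_spec hex
  cases j with
  | zero =>
    have h0 : l 0 = 1 := rfl
    have := one_le_of_mem_LuckySet h
    omega
  | succ j =>
    have hlt : l j < n := not_le.1 (Nat.find_min hex (m := j) (by omega))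
    refine ⟨j + 1, by omega, le_antisymm ?_ hle⟩
    rw [l_succ]
    exact Nat.sInf_le ⟨Set.mem_iInter.1 h j, hlt⟩

theorem star_l_succ (i m : ℕ) :
    star (l (i + 1)) m = Nat.nth (· ∈ A i) (l (i + 1) * m - 1) := by
  have : {j | 1 ≤ j ∧ l j = l (i + 1)} = {i + 1} := by
    ext j
    simp only [Set.mem_ofPred_eq, Set.mem_singleton_iff, l_strictMono.injective.eq_iff]
    omega
  rw [star, this, csInf_singleton]
  rfl

theorem exists_l_succ_of_mem_Ell {a : ℕ} (h : a ∈ Ell) : ∃ i, a = l (i + 1) := by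
  obtain ⟨i, hi, rfl⟩ := h
  exact ⟨i - 1, by rw [Nat.sub_add_cancel hi]⟩

theorem star_l_succ_mem (i m : ℕ) : star (l (i + 1)) m ∈ A i := by
  rw [star_l_succ]
  exact Nat.nth_mem_of_infinite (A_infinite i) _

theorem rank_star (i : ℕ) {m : ℕ} (hm : 1 ≤ m) :
    rank (A i) (star (l (i + 1)) m) = l (i + 1) * m := by
  rw [star_l_succ, rank_nth (A_infinite i)]
  have := Nat.mul_pos (n := l (i + 1)) (by have := two_le_l_succ i; omega) hm
  omega

theorem star_l_succ_notMem (i : ℕ) {m : ℕ} (hm : 1 ≤ m) :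
    star (l (i + 1)) m ∉ A (i + 1) := by
  rw [A_succ]
  exact fun h => h.2 (rank_star i hm ▸ dvd_mul_right _ _)

theorem one_le_star {a : ℕ} (ha : a ∈ Ell) (m : ℕ) : 1 ≤ star a m := by
  obtain ⟨i, rfl⟩ := exists_l_succ_of_mem_Ell ha
  exact one_le_of_mem_A (star_l_succ_mem i m)

theorem star_notMem_LuckySet {a m : ℕ} (ha : a ∈ Ell) (hm : 1 ≤ m) : star a m ∉ LuckySet := by
  obtain ⟨i, rfl⟩ := exists_l_succ_of_mem_Ell ha
  exact fun h => star_l_succ_notMem i hm (Set.mem_iInter.1 h (i + 1))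

theorem star_inj {a a' m m' : ℕ} (ha : a ∈ Ell) (ha' : a' ∈ Ell) (hm : 1 ≤ m) (hm' : 1 ≤ m')
    (h : star a m = star a' m') : a = a' ∧ m = m' := by
  obtain ⟨i, rfl⟩ := exists_l_succ_of_mem_Ell ha
  obtain ⟨j, rfl⟩ := exists_l_succ_of_mem_Ell ha'
  have hij : i = j := by
    rcases lt_trichotomy i j with hlt | heq | hlt
    · exact absurd (A_antitone hlt (h ▸ star_l_succ_mem j m')) (star_l_succ_notMem i hm)
    · exact heq
    · exact absurd (A_antitone hlt (h ▸ star_l_succ_mem i m)) (star_l_succ_notMem j hm')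
  subst hij
  refine ⟨rfl, ?_⟩
  have hr := rank_star i hm
  rw [h, rank_star i hm'] at hr
  exact (Nat.eq_of_mul_eq_mul_left (by have := two_le_l_succ i; omega) hr).symm

theorem exists_star_of_notMem_LuckySet {n : ℕ} (hn : 1 ≤ n) (h : n ∉ LuckySet) :
    ∃ a ∈ Ell, ∃ m, 1 ≤ m ∧ m < n ∧ star a m = n := by
  classical
  have hex : ∃ i, n ∉ A i := by simpa [LuckySet] using h
  obtain ⟨j, hj⟩ : ∃ j, Nat.find hex = j := ⟨_, rfl⟩
  have hnot : n ∉ A j := hj ▸ Nat.find_spec hex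
  cases j with
  | zero => exact absurd hn hnot
  | succ i =>
    have hmem : n ∈ A i := not_not.1 (Nat.find_min hex (m := i) (by omega))
    obtain ⟨m, hm⟩ : l (i + 1) ∣ rank (A i) n := by
      by_contra hd
      exact hnot (A_succ i ▸ ⟨hmem, hd⟩)
    have hpos : 0 < rank (A i) n := by
      rw [rank_eq_count, Nat.count_succ, if_pos hmem]
      omega
    have hle : rank (A i) n ≤ n := by
      rw [rank_eq_count, Nat.count_succ', if_neg fun h0 => absurd (one_le_of_mem_A h0) (by omega)]
      exact Nat.count_le _
    have hm1 : 1 ≤ m := Nat.pos_of_ne_zero fun h0 => by simp [h0] at hm; omega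
    have hl := two_le_l_succ i
    refine ⟨l (i + 1), ⟨i + 1, by omega, rfl⟩, m, hm1, by nlinarith, ?_⟩
    rw [star_l_succ, ← hm, nth_rank hmem]

theorem evalStar_concat (u : List ℕ) (x : ℕ) : evalStar (u ++ [x]) = u.foldr star x := by
  induction u with
  | nil => rfl
  | cons a u ih =>
    rw [List.foldr_cons, ← ih]
    cases u <;> rfl

theorem getLast!_concat (u : List ℕ) (x : ℕ) : (u ++ [x]).getLast! = x := by
  rw [List.getLast!_eq_getLast?_getD]
  simp

theorem isLuckyFactorization_concat {n : ℕ} {u : List ℕ} {x : ℕ} :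
    IsLuckyFactorization n (u ++ [x]) ↔
      (∀ a ∈ u, a ∈ Ell) ∧ x ∈ LuckySet ∧ u.foldr star x = n := by
  simp [IsLuckyFactorization, evalStar_concat]

theorem IsLuckyFactorization.exists_concat {n : ℕ} {t : List ℕ} (h : IsLuckyFactorization n t) :
    ∃ u x, t = u ++ [x] ∧ (∀ a ∈ u, a ∈ Ell) ∧ x ∈ LuckySet ∧ u.foldr star x = n := by
  have ht : t = t.dropLast ++ [t.getLast h.1] := (List.dropLast_append_getLast h.1).symm
  exact ⟨_, _, ht, isLuckyFactorization_concat.1 (ht ▸ h)⟩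

theorem exists_isLuckyFactorization {n : ℕ} (hn : 1 ≤ n) : ∃ t, IsLuckyFactorization n t := by
  induction n using Nat.strong_induction_on with
  | _ n ih =>
    by_cases h : n ∈ LuckySet
    · exact ⟨[] ++ [n], isLuckyFactorization_concat.2 ⟨by simp, h, rfl⟩⟩
    · obtain ⟨a, ha, m, hm1, hmn, rfl⟩ := exists_star_of_notMem_LuckySet hn h
      obtain ⟨t, ht⟩ := ih m hmn hm1
      obtain ⟨u, x, rfl, hu, hx, rfl⟩ := ht.exists_concat
      exact ⟨(a :: u) ++ [x], isLuckyFactorization_concat.2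
        ⟨List.forall_mem_cons.2 ⟨ha, hu⟩, hx, rfl⟩⟩

theorem one_le_foldr_star {u : List ℕ} (hu : ∀ a ∈ u, a ∈ Ell) {x : ℕ} (hx : 1 ≤ x) :
    1 ≤ u.foldr star x := by
  cases u with
  | nil => exact hx
  | cons a u => exact one_le_star (hu a (by simp)) _

theorem foldr_star_inj {u v : List ℕ} {x y : ℕ} (hu : ∀ a ∈ u, a ∈ Ell) (hv : ∀ a ∈ v, a ∈ Ell)
    (hx : x ∈ LuckySet) (hy : y ∈ LuckySet) (h : u.foldr star x = v.foldr star y) :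
    u = v ∧ x = y := by
  have hx1 := one_le_of_mem_LuckySet hx
  have hy1 := one_le_of_mem_LuckySet hy
  induction u generalizing v with
  | nil =>
    cases v with
    | nil => exact ⟨rfl, h⟩
    | cons b v =>
      rw [List.forall_mem_cons] at hv
      change x = star b _ at h
      exact absurd (h ▸ hx) (star_notMem_LuckySet hv.1 (one_le_foldr_star hv.2 hy1))
  | cons a u ih =>
    rw [List.forall_mem_cons] at hu
    cases v with
    | nil =>
      change star a _ = y at h
      exact absurd (h ▸ hy) (star_notMem_LuckySet hu.1 (one_le_foldr_star hu.2 hx1))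
    | cons b v =>
      rw [List.forall_mem_cons] at hv
      obtain ⟨rfl, h'⟩ := star_inj hu.1 hv.1 (one_le_foldr_star hu.2 hx1)
        (one_le_foldr_star hv.2 hy1) h
      obtain ⟨rfl, rfl⟩ := ih hu.2 hv.2 h'
      exact ⟨rfl, rfl⟩

theorem IsLuckyFactorization.unique {n : ℕ} {s t : List ℕ} (hs : IsLuckyFactorization n s)
    (ht : IsLuckyFactorization n t) : s = t := by
  obtain ⟨u, x, rfl, hu, hx, h⟩ := hs.exists_concat
  obtain ⟨v, y, rfl, hv, hy, h'⟩ := ht.exists_concat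
  obtain ⟨rfl, rfl⟩ := foldr_star_inj hu hv hx hy (h.trans h'.symm)
  rfl

theorem isLuckyFactorization_canonicalTuple {n : ℕ} (hn : 1 ≤ n) :
    IsLuckyFactorization n (canonicalTuple n) := by
  have h := exists_isLuckyFactorization hn
  rw [canonicalTuple, dif_pos h]
  exact h.choose_spec

theorem IsLuckyFactorization.canonicalTuple_eq {n : ℕ} {t : List ℕ}
    (h : IsLuckyFactorization n t) (hn : 1 ≤ n) : canonicalTuple n = t :=
  (isLuckyFactorization_canonicalTuple hn).unique h

theorem one_le_of_mem_Sset {a : ℕ} (ha : a ∈ Sset) : 1 ≤ a := by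
  rcases ha with ha | ha <;> exact ha.1

theorem mem_Ell_of_mem_ellTuple {a : ℕ} (ha : a ∈ Sset) : ∀ t ∈ ellTuple a, t ∈ Ell := by
  obtain ⟨u, x, ht, hu, hx, -⟩ :=
    (isLuckyFactorization_canonicalTuple (one_le_of_mem_Sset ha)).exists_concat
  rw [ellTuple, ht, getLast!_concat, List.dropLast_concat]
  split_ifs with h1
  · exact hu
  · simpa [or_imp, forall_and] using ⟨hu, mem_Ell_of_mem_LuckySet hx h1⟩

theorem canonicalTuple_circ {a b : ℕ} (ha : a ∈ Sset) (hb : 1 ≤ b) :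
    1 ≤ circ a b ∧ canonicalTuple (circ a b) = ellTuple a ++ canonicalTuple b := by
  have hE := mem_Ell_of_mem_ellTuple ha
  obtain ⟨v, y, hv, hvE, hy, rfl⟩ := (isLuckyFactorization_canonicalTuple hb).exists_concat
  have h1 : 1 ≤ circ a (v.foldr star y) := one_le_foldr_star hE hb
  refine ⟨h1, IsLuckyFactorization.canonicalTuple_eq ?_ h1⟩
  rw [hv, ← List.append_assoc, isLuckyFactorization_concat]
  refine ⟨fun t ht => (List.mem_append.1 ht).elim (hE t) (hvE t), hy, ?_⟩
  rw [List.foldr_append, circ]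

theorem getLast!_canonicalTuple_circ {a b : ℕ} (ha : a ∈ Sset) (hb : 1 ≤ b) :
    (canonicalTuple (circ a b)).getLast! = (canonicalTuple b).getLast! := by
  obtain ⟨v, y, hv, -⟩ := (isLuckyFactorization_canonicalTuple hb).exists_concat
  rw [(canonicalTuple_circ ha hb).2, hv, ← List.append_assoc, getLast!_concat, getLast!_concat]

theorem circ_mem_Sset {a b : ℕ} (ha : a ∈ Sset) (hb : b ∈ Sset) : circ a b ∈ Sset := by
  have hb1 := one_le_of_mem_Sset hb
  obtain ⟨h1, ht⟩ := canonicalTuple_circ ha hb1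
  rcases hb with hb | ⟨-, t, hbt⟩
  · exact Or.inl ⟨h1, getLast!_canonicalTuple_circ ha hb1 ▸ hb.2⟩
  · exact Or.inr ⟨h1, ellTuple a ++ t, by rw [ht, hbt, List.append_assoc]⟩

theorem ellTuple_circ {a b : ℕ} (ha : a ∈ Sset) (hb : 1 ≤ b) :
    ellTuple (circ a b) = ellTuple a ++ ellTuple b := by
  have hne := (isLuckyFactorization_canonicalTuple hb).1
  rw [ellTuple, getLast!_canonicalTuple_circ ha hb, (canonicalTuple_circ ha hb).2, ellTuple.eq_def b]
  split_ifs
  · exact List.dropLast_append_of_ne_nil hne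
  · rfl

/-- associativity of the extended operation `∘`: for all `a, b ∈ S` and
every positive integer `c`, one has `a∘b ∈ S` and `a∘(b∘c) = (a∘b)∘c`. -/
theorem circ_assoc (a b : ℕ) (ha : a ∈ Sset) (hb : b ∈ Sset) (c : ℕ) (hc : 1 ≤ c) :
    circ a b ∈ Sset ∧ circ a (circ b c) = circ (circ a b) c := by
  refine ⟨circ_mem_Sset ha hb, ?_⟩
  rw [circ, circ, circ, ellTuple_circ ha (one_le_of_mem_Sset hb), List.foldr_append]

end LuckyPaper
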